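/- For every ε > 0, there exist δ > 0 and n₀ such that for all integers n ≥ n₀ the following holds: if A ⊆ [n] satisfies g(A, 4) ≥ 4^{n/2 - δn}, then either |A △ [n]| ≤ εn, or |A △ O| ≤ εn, or |A △ I₀| ≤ εn, where O = {1, 3, 5, ..., 2⌈n/2⌉ - 1} is the set of odd numbers in [n] and I₀ = [⌊n/2⌋ + 1, n]. -/

import Mathlib

open Finset

/-- The number of rainbow sum-free `r`-colorings of a finite set `A` of positive
integers. -/
noncomputable def numRSF (r : ℕ) (A : Finset ℕ) : ℕ :=
  Nat.card {f : ↥A → Fin r //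
    ∀ x y z : ↥A, (x : ℕ) + (y : ℕ) = (z : ℕ) →
      ¬(f x ≠ f y ∧ f x ≠ f z ∧ f y ≠ f z)}

/-- The number of subsets of size at most `s`, bounded by a generating function. -/
lemma card_powerset_filter_le {V : Type*} (C : Finset V) (s : ℕ) {q : ℝ}
    (hq0 : 0 < q) (hq1 : q ≤ 1) :
    (#{S ∈ C.powerset | #S ≤ s} : ℝ) * q ^ s ≤ (1 + q) ^ #C := by
  calc (#{S ∈ C.powerset | #S ≤ s} : ℝ) * q ^ s = ∑ S ∈ C.powerset with #S ≤ s, q ^ s := by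
        rw [sum_const, nsmul_eq_mul]
    _ ≤ ∑ S ∈ C.powerset with #S ≤ s, q ^ #S := by
        refine sum_le_sum fun S hS => pow_le_pow_of_le_one hq0.le hq1 (mem_filter.1 hS).2
    _ ≤ ∑ S ∈ C.powerset, q ^ #S :=
        sum_le_sum_of_subset_of_nonneg (filter_subset _ _) fun _ _ _ => by positivity
    _ = (1 + q) ^ #C := by
        rw [add_comm, ← sum_pow_mul_eq_add_pow]
        simp

section Containers

variable {V : Type*} [DecidableEq V]

/-- Some `R ⊆ I` of size at most `#C / t` determines a container of the independent set `I`. -/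
lemma exists_graph_fingerprint (C I : Finset V) (G : V → V → Prop) [DecidableRel G] {t : ℕ}
    (ht : 0 < t) (hind : ∀ v ∈ I, ∀ w ∈ I, ¬ G v w) :
    ∃ R ⊆ I, t * #R ≤ #C ∧ ∀ v ∈ I, (¬ ∃ u ∈ R, G u v) ∧
      #{w ∈ C | (¬ ∃ u ∈ R, G u w) ∧ G v w} < t := by
  have hne : (I.powerset.filter fun R => t * #R ≤ #{w ∈ C | ∃ u ∈ R, G u w}).Nonempty :=
    ⟨∅, by simp⟩
  obtain ⟨R, hR, hmax⟩ := exists_max_image _ card hne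
  rw [mem_filter, mem_powerset] at hR
  refine ⟨R, hR.1, hR.2.trans (card_le_card (filter_subset _ _)), fun v hv => ⟨?_, ?_⟩⟩
  · rintro ⟨u, hu, huv⟩
    exact hind u (hR.1 hu) v hv huv
  · by_contra hc
    rw [not_lt] at hc
    by_cases hvR : v ∈ R
    · have : {w ∈ C | (¬ ∃ u ∈ R, G u w) ∧ G v w} = ∅ :=
        filter_eq_empty_iff.2 fun w _ hw => hw.1 ⟨v, hvR, hw.2⟩
      rw [this, card_empty] at hc
      omega
    · have h1 : insert v R ∈
          (I.powerset.filter fun R => t * #R ≤ #{w ∈ C | ∃ u ∈ R, G u w}) := by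
        rw [mem_filter, mem_powerset]
        refine ⟨insert_subset hv hR.1, ?_⟩
        rw [card_insert_of_notMem hvR, mul_add, mul_one]
        refine (add_le_add hR.2 hc).trans ?_
        rw [← card_union_of_disjoint]
        · refine card_le_card fun w hw => ?_
          simp only [mem_union, mem_filter, mem_insert, exists_eq_or_imp] at hw ⊢
          tauto
        · rw [disjoint_filter]
          exact fun x _ h1 h2 => h2.1 h1
      have := hmax _ h1
      rw [card_insert_of_notMem hvR] at this
      omega

/-- The vertices which can lie in an independent set having fingerprint `R`. -/
def graphContainer (C R : Finset V) (G : V → V → Prop) [DecidableRel G] (t : ℕ) : Finset V :=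
  {v ∈ C | (¬ ∃ u ∈ R, G u v) ∧ #{w ∈ C | (¬ ∃ u ∈ R, G u w) ∧ G v w} < t}

lemma card_edges_add_le (C R : Finset V) (G : V → V → Prop) [DecidableRel G] {t d : ℕ}
    (hout : ∀ v, #{w ∈ C | G v w} ≤ d) (hin : ∀ w, #{v ∈ C | G v w} ≤ d) :
    #{e ∈ C ×ˢ C | G e.1 e.2} + 2 * d * #(graphContainer C R G t) ≤ (2 * d + t) * #C := by
  set K := graphContainer C R G t with hK
  set P := {e ∈ C ×ˢ C | G e.1 e.2} with hP
  set X := {v ∈ C | ∃ u ∈ R, G u v} with hX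
  set Y := {v ∈ C | t ≤ #{w ∈ C | (¬ ∃ u ∈ R, G u w) ∧ G v w}} with hY
  have hKC : K ⊆ C := filter_subset _ _
  have hXK : #X ≤ #C - #K := by
    rw [← card_sdiff_of_subset hKC]
    refine card_le_card fun v hv => ?_
    simp only [hX, hK, graphContainer, mem_filter, mem_sdiff] at hv ⊢
    exact ⟨hv.1, fun h => h.2.1 hv.2⟩
  have hYK : #Y ≤ #C - #K := by
    rw [← card_sdiff_of_subset hKC]
    refine card_le_card fun v hv => ?_
    simp only [hY, hK, graphContainer, mem_filter, mem_sdiff] at hv ⊢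
    exact ⟨hv.1, fun h => absurd hv.2 (not_le.2 h.2.2)⟩
  have h1 : #{e ∈ P | e.2 ∈ X} ≤ d * #X := by
    refine card_le_mul_card_image_of_maps_to (f := Prod.snd) (fun e he => (mem_filter.1 he).2) d
      fun w _ => (card_le_card_of_injOn Prod.fst (fun e he => ?_) ?_).trans (hin w)
    · simp only [hP, coe_filter, mem_filter, mem_product, Set.mem_ofPred_eq] at he ⊢
      rw [← he.2]
      tauto
    · intro e he e' he' h
      simp only [coe_filter, Set.mem_ofPred_eq] at he he'
      exact Prod.ext h (he.2.trans he'.2.symm)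
  have h2 : #{e ∈ {e ∈ P | e.2 ∉ X} | e.1 ∈ Y} ≤ d * #Y := by
    refine card_le_mul_card_image_of_maps_to (f := Prod.fst) (fun e he => (mem_filter.1 he).2) d
      fun v _ => (card_le_card_of_injOn Prod.snd (fun e he => ?_) ?_).trans (hout v)
    · simp only [hP, coe_filter, mem_filter, mem_product, Set.mem_ofPred_eq] at he ⊢
      rw [← he.2]
      tauto
    · intro e he e' he' h
      simp only [coe_filter, Set.mem_ofPred_eq] at he he'
      exact Prod.ext (he.2.trans he'.2.symm) h
  have h3 : #{e ∈ {e ∈ P | e.2 ∉ X} | e.1 ∉ Y} ≤ t * #C := by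
    refine card_le_mul_card_image_of_maps_to (f := Prod.fst) (fun e he => ?_) t
      fun v hv => ?_
    · simp only [hP, mem_filter, mem_product] at he
      exact he.1.1.1.1
    · by_cases hvY : v ∈ Y
      · rw [filter_eq_empty_iff.2, card_empty]
        · exact Nat.zero_le _
        · rintro e he rfl
          exact (mem_filter.1 he).2 hvY
      · simp only [hY, mem_filter, hv, true_and, not_le] at hvY
        refine (card_le_card_of_injOn Prod.snd (fun e he => ?_) ?_).trans hvY.le
        · simp only [hP, hX, coe_filter, mem_filter, mem_product, Set.mem_ofPred_eq] at he ⊢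
          rw [← he.2]
          exact ⟨he.1.1.1.1.2, fun h => he.1.1.2 ⟨he.1.1.1.1.2, h⟩, he.1.1.1.2⟩
        · intro e he e' he' h
          simp only [coe_filter, Set.mem_ofPred_eq] at he he'
          exact Prod.ext (he.2.trans he'.2.symm) h
  have e1 := card_filter_add_card_filter_not (s := P) (fun e => e.2 ∈ X)
  have e2 := card_filter_add_card_filter_not (s := {e ∈ P | e.2 ∉ X}) (fun e => e.1 ∈ Y)
  have := card_le_card hKC
  have hle : #P ≤ d * (#C - #K) + (d * (#C - #K) + t * #C) := by
    have := Nat.mul_le_mul_left d hXK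
    have := Nat.mul_le_mul_left d hYK
    omega
  obtain ⟨m, hm⟩ := Nat.exists_eq_add_of_le this
  rw [hm] at hle ⊢
  rw [Nat.add_sub_cancel_left] at hle
  nlinarith

/-- A 3-uniform (ordered) hypergraph in which two vertices lie in at most 4 edges. -/
structure BoundedCodegree (H : V → V → V → Prop) [∀ u v w, Decidable (H u v w)] : Prop where
  fst : ∀ (C : Finset V) (v w : V), #{u ∈ C | H u v w} ≤ 4
  snd : ∀ (C : Finset V) (u w : V), #{v ∈ C | H u v w} ≤ 4
  thd : ∀ (C : Finset V) (u v : V), #{w ∈ C | H u v w} ≤ 4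

/-- The edges of the hypergraph `H` inside `C`. -/
def hyperedges (H : V → V → V → Prop) [∀ u v w, Decidable (H u v w)] (C : Finset V) :
    Finset (V × V × V) :=
  {e ∈ C ×ˢ C ×ˢ C | H e.1 e.2.1 e.2.2}

variable {H : V → V → V → Prop} [∀ u v w, Decidable (H u v w)]

lemma card_hyperedges_le (hH : BoundedCodegree H) (C : Finset V) (g : ℕ) :
    #(hyperedges H C) ≤
      4 * #C * #{u ∈ C | g ≤ #{e ∈ C ×ˢ C | H u e.1 e.2}} + g * #C := by
  set L := {u ∈ C | g ≤ #{e ∈ C ×ˢ C | H u e.1 e.2}} with hL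
  rw [← card_filter_add_card_filter_not (s := hyperedges H C) (fun e => e.1 ∈ L)]
  have hfib : ∀ (P : Finset (V × V × V)) (u : V), P ⊆ hyperedges H C →
      #{e ∈ P | e.1 = u} ≤ #{e ∈ C ×ˢ C | H u e.1 e.2} := by
    intro P u hP
    refine card_le_card_of_injOn Prod.snd (fun e he => ?_) ?_
    · simp only [coe_filter, Set.mem_ofPred_eq] at he ⊢
      have := hP he.1
      simp only [hyperedges, mem_filter, mem_product] at this ⊢
      rw [← he.2]
      tauto
    · intro e he e' he' h
      simp only [coe_filter, Set.mem_ofPred_eq] at he he'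
      exact Prod.ext (he.2.trans he'.2.symm) h
  refine add_le_add ?_ ?_
  · refine card_le_mul_card_image_of_maps_to (f := Prod.fst) (fun e he => (mem_filter.1 he).2) _
      fun u _ => (hfib _ u (filter_subset _ _)).trans ?_
    refine card_le_mul_card_image_of_maps_to (f := Prod.fst) (t := C) (fun e he => ?_) _
      fun v _ => (card_le_card_of_injOn Prod.snd (fun e he => ?_) ?_).trans (hH.thd C u v)
    · simp only [mem_filter, mem_product] at he
      exact he.1.1
    · simp only [coe_filter, mem_filter, mem_product, Set.mem_ofPred_eq] at he ⊢
      rw [← he.2]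
      tauto
    · intro e he e' he' h
      simp only [coe_filter, Set.mem_ofPred_eq] at he he'
      exact Prod.ext (he.2.trans he'.2.symm) h
  · refine card_le_mul_card_image_of_maps_to (f := Prod.fst) (fun e he => ?_) _ fun u hu => ?_
    · simp only [hyperedges, mem_filter, mem_product] at he
      exact he.1.1.1
    · by_cases huL : u ∈ L
      · rw [filter_eq_empty_iff.2, card_empty]
        · exact Nat.zero_le _
        · rintro e he rfl
          exact (mem_filter.1 he).2 huL
      · simp only [hL, mem_filter, hu, true_and, not_le] at huL
        exact (hfib _ u (filter_subset _ _)).trans huL.le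

/-- One step of the container algorithm: a set with many hyperedges is covered by few smaller
containers, one of which captures many of the independent sets. -/
lemma exists_container_step (hH : BoundedCodegree H) (C : Finset V) (𝓕 : Finset (Finset V))
    (h𝓕 : ∀ I ∈ 𝓕, ∀ u ∈ I, ∀ v ∈ I, ∀ w ∈ I, ¬ H u v w) {M g s t K : ℕ} (hM : #C ≤ M)
    (hM0 : 0 < M) (hs0 : 0 < s) (ht0 : 0 < t) (hgs : 8 * s ≤ g) (htM : 8 * t * M ≤ s * g)
    (hMt : M ≤ t * s) (hK : #{S ∈ C.powerset | #S ≤ s} ≤ K)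
    (hC : 2 * g * M ≤ #(hyperedges H C)) :
    ∃ C' ⊆ C, 64 * #C' + g ≤ 64 * #C ∧
      #{I ∈ 𝓕 | I ⊆ C} ≤ K ^ 2 * #{I ∈ 𝓕 | I ⊆ C'} := by
  classical
  set L := {u ∈ C | g ≤ #{e ∈ C ×ˢ C | H u e.1 e.2}} with hL
  have hLC : L ⊆ C := filter_subset _ _
  have hLg : g ≤ 4 * #L := by
    have h1 := card_hyperedges_le hH C g
    rw [← hL] at h1
    have h2 : 4 * #C * #L ≤ 4 * M * #L := by gcongr
    have h3 : g * #C ≤ g * M := by gcongr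
    have h4 : M * g ≤ M * (4 * #L) := by nlinarith
    exact Nat.le_of_mul_le_mul_left h4 hM0
  set G : Finset V → V → V → Prop := fun S v w => ∃ u ∈ S, H u v w with hG
  set κ : Finset V × Finset V → Finset V := fun p =>
    if #p.1 < s then C \ L ∪ p.1 else graphContainer C p.2 (G p.1) t with hκ
  set J := {S ∈ L.powerset | #S ≤ s} ×ˢ {S ∈ C.powerset | #S ≤ s} with hJ
  have hJK : #J ≤ K ^ 2 := by
    rw [hJ, card_product, sq]
    refine Nat.mul_le_mul (le_trans (card_le_card ?_) hK) hK
    exact filter_subset_filter _ (powerset_mono.2 hLC)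
  have hκC : ∀ p ∈ J, κ p ⊆ C := by
    intro p hp
    simp only [hJ, mem_product, mem_filter, mem_powerset] at hp
    simp only [hκ]
    split_ifs
    · exact union_subset sdiff_subset (hp.1.1.trans hLC)
    · exact filter_subset _ _
  have hκcard : ∀ p ∈ J, 64 * #(κ p) + g ≤ 64 * #C := by
    rintro ⟨S, R⟩ hp
    simp only [hJ, mem_product, mem_filter, mem_powerset] at hp
    simp only [hκ]
    split_ifs with hS
    · have h1 := card_union_le (C \ L) S
      rw [card_sdiff_of_subset hLC] at h1
      have := card_le_card hLC
      omega
    · have hS' : #S = s := by omega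
      have hout : ∀ v, #{w ∈ C | G S v w} ≤ 4 * s := by
        intro v
        rw [← hS', mul_comm]
        refine le_trans (card_le_card ?_) (card_biUnion_le_card_mul S
          (fun u => {w ∈ C | H u v w}) 4 fun u _ => hH.thd C u v)
        intro w hw
        simp only [hG, mem_filter, mem_biUnion] at hw ⊢
        obtain ⟨h1, u, h2, h3⟩ := hw
        exact ⟨u, h2, h1, h3⟩
      have hin : ∀ w, #{v ∈ C | G S v w} ≤ 4 * s := by
        intro w
        rw [← hS', mul_comm]
        refine le_trans (card_le_card ?_) (card_biUnion_le_card_mul S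
          (fun u => {v ∈ C | H u v w}) 4 fun u _ => hH.snd C u w)
        intro v hv
        simp only [hG, mem_filter, mem_biUnion] at hv ⊢
        obtain ⟨h1, u, h2, h3⟩ := hv
        exact ⟨u, h2, h1, h3⟩
      have h1 := card_edges_add_le C R (G S) (t := t) hout hin
      have h2 : s * g ≤ 4 * #{e ∈ C ×ˢ C | G S e.1 e.2} := by
        calc s * g ≤ #(S.sigma fun u => {e ∈ C ×ˢ C | H u e.1 e.2}) := by
              rw [card_sigma, ← hS', ← smul_eq_mul]
              exact card_nsmul_le_sum _ _ _ fun u hu => (mem_filter.1 (hp.1.1 hu)).2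
          _ ≤ _ := by
              refine card_le_mul_card_image_of_maps_to (f := Sigma.snd) (fun e he => ?_) 4
                fun e he => (card_le_card_of_injOn Sigma.fst (fun x hx => ?_) ?_).trans
                  (hH.fst C e.1 e.2)
              · simp only [mem_sigma, mem_filter] at he ⊢
                exact ⟨he.2.1, e.1, he.1, he.2.2⟩
              · simp only [coe_filter, mem_sigma, mem_filter, Set.mem_ofPred_eq] at hx ⊢
                rw [← hx.2]
                exact ⟨hLC (hp.1.1 hx.1.1), hx.1.2.2⟩
              · rintro ⟨x, y⟩ hx ⟨x', y'⟩ hx' h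
                simp only [coe_filter, Set.mem_ofPred_eq] at hx hx' h
                rw [h, hx.2, hx'.2]
      have h3 := card_le_card (filter_subset _ _ : graphContainer C R (G S) t ⊆ C)
      have h4 : t * #C ≤ t * M := by gcongr
      have h5 : s * (64 * #(graphContainer C R (G S) t) + g) ≤ s * (64 * #C) := by nlinarith
      exact Nat.le_of_mul_le_mul_left h5 hs0
  have hcover : ∀ I ∈ 𝓕, I ⊆ C → ∃ p ∈ J, I ⊆ κ p := by
    intro I hI hIC
    rcases lt_or_ge (#(I ∩ L)) s with hlt | hge
    · refine ⟨(I ∩ L, ∅), ?_, ?_⟩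
      · simp only [hJ, mem_product, mem_filter, mem_powerset]
        exact ⟨⟨inter_subset_right, hlt.le⟩, empty_subset _, by simp⟩
      · simp only [hκ, hlt, if_true]
        intro v hv
        have := hIC hv
        simp only [mem_union, mem_sdiff, mem_inter]
        tauto
    · obtain ⟨S, hS, hScard⟩ := exists_subset_card_eq hge
      obtain ⟨R, hR, hRcard, hR2⟩ := exists_graph_fingerprint C I (G S) ht0 (by
        rintro v hv w hw ⟨u, hu, huvw⟩
        exact h𝓕 I hI u (mem_inter.1 (hS hu)).1 v hv w hw huvw)
      refine ⟨(S, R), ?_, ?_⟩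
      · simp only [hJ, mem_product, mem_filter, mem_powerset]
        exact ⟨⟨hS.trans inter_subset_right, hScard.le⟩, hR.trans hIC,
          Nat.le_of_mul_le_mul_left (hRcard.trans (hM.trans hMt)) ht0⟩
      · simp only [hκ, hScard, lt_irrefl, if_false]
        exact fun v hv => mem_filter.2 ⟨hIC hv, hR2 v hv⟩
  have hJne : J.Nonempty := ⟨(∅, ∅), by simp [hJ]⟩
  obtain ⟨p, hp, hpmax⟩ := exists_max_image J (fun p => #{I ∈ 𝓕 | I ⊆ κ p}) hJne
  refine ⟨κ p, hκC p hp, hκcard p hp, ?_⟩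
  calc #{I ∈ 𝓕 | I ⊆ C} ≤ #(J.biUnion fun p => {I ∈ 𝓕 | I ⊆ κ p}) := by
        refine card_le_card fun I hI => ?_
        rw [mem_filter] at hI
        obtain ⟨q, hq, hIq⟩ := hcover I hI.1 hI.2
        exact mem_biUnion.2 ⟨q, hq, mem_filter.2 ⟨hI.1, hIq⟩⟩
    _ ≤ #J * #{I ∈ 𝓕 | I ⊆ κ p} := card_biUnion_le_card_mul _ _ _ hpmax
    _ ≤ _ := Nat.mul_le_mul_right _ hJK

/-- A hypergraph container statement: some set with few hyperedges captures many of the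
independent sets. -/
lemma exists_container (hH : BoundedCodegree H) (𝓕 : Finset (Finset V))
    (h𝓕 : ∀ I ∈ 𝓕, ∀ u ∈ I, ∀ v ∈ I, ∀ w ∈ I, ¬ H u v w) {M g s t K : ℕ}
    (hM0 : 0 < M) (hs0 : 0 < s) (ht0 : 0 < t) (hgs : 8 * s ≤ g) (htM : 8 * t * M ≤ s * g)
    (hMt : M ≤ t * s) (hK1 : 1 ≤ K) (k : ℕ) (C : Finset V) (hM : #C ≤ M)
    (hK : #{S ∈ C.powerset | #S ≤ s} ≤ K) (hk : 64 * #C ≤ k * g) :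
    ∃ C' ⊆ C, #(hyperedges H C') < 2 * g * M ∧
      #{I ∈ 𝓕 | I ⊆ C} ≤ (K ^ 2) ^ k * #{I ∈ 𝓕 | I ⊆ C'} := by
  induction k generalizing C with
  | zero =>
    have : C = ∅ := by rw [← card_eq_zero]; omega
    subst this
    refine ⟨∅, subset_rfl, ?_, by simp⟩
    have : 0 < g := by omega
    simp only [hyperedges, empty_product, filter_empty, card_empty]
    positivity
  | succ k ih =>
    by_cases hC : 2 * g * M ≤ #(hyperedges H C)
    · obtain ⟨C₁, hC₁, hcard, hcount⟩ :=
        exists_container_step hH C 𝓕 h𝓕 hM hM0 hs0 ht0 hgs htM hMt hK hC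
      obtain ⟨C₂, hC₂, hedges, hcount₂⟩ := ih C₁ ((card_le_card hC₁).trans hM)
        ((card_le_card (filter_subset_filter _ (powerset_mono.2 hC₁))).trans hK)
        (by rw [add_mul] at hk; omega)
      refine ⟨C₂, hC₂.trans hC₁, hedges, hcount.trans ?_⟩
      rw [pow_succ' (K ^ 2), mul_assoc]
      exact Nat.mul_le_mul_left _ hcount₂
    · refine ⟨C, subset_rfl, not_le.1 hC, Nat.le_mul_of_pos_left _ (by positivity)⟩

end Containers

open Classical in
/-- The number of `x ∈ {1, …, n}` satisfying `p`. -/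
noncomputable def cnt (n : ℕ) (p : ℕ → Prop) : ℕ := #{x ∈ Icc 1 n | p x}

section Counting

variable {n : ℕ} {p q r : ℕ → Prop}

lemma cnt_le_add (h : ∀ x, 1 ≤ x → x ≤ n → p x → q x ∨ r x) : cnt n p ≤ cnt n q + cnt n r := by
  classical
  unfold cnt
  refine le_trans (card_le_card ?_) (card_union_le _ _)
  intro x hx
  simp only [mem_filter, mem_Icc, mem_union] at hx ⊢
  rcases h x hx.1.1 hx.1.2 hx.2 with h | h <;> tauto

lemma cnt_map (f : ℕ → ℕ)
    (h : ∀ x, 1 ≤ x → x ≤ n → p x → 1 ≤ f x ∧ f x ≤ n ∧ q (f x))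
    (hinj : ∀ x y, p x → p y → f x = f y → x = y) : cnt n p ≤ cnt n q := by
  classical
  unfold cnt
  refine card_le_card_of_injOn f ?_ ?_
  · intro x hx
    simp only [coe_filter, mem_Icc, Set.mem_ofPred_eq] at hx ⊢
    have := h x hx.1.1 hx.1.2 hx.2
    tauto
  · intro x hx y hy hxy
    simp only [coe_filter, mem_Icc, Set.mem_ofPred_eq] at hx hy
    exact hinj x y hx.2 hy.2 hxy

lemma cnt_mono (h : ∀ x, 1 ≤ x → x ≤ n → p x → q x) : cnt n p ≤ cnt n q :=
  cnt_map id (fun x h1 h2 h3 => ⟨h1, h2, h x h1 h2 h3⟩) (fun _ _ _ _ h => h)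

lemma cnt_congr (h : ∀ x, 1 ≤ x → x ≤ n → (p x ↔ q x)) : cnt n p = cnt n q :=
  le_antisymm (cnt_mono fun x h1 h2 => (h x h1 h2).1) (cnt_mono fun x h1 h2 => (h x h1 h2).2)

lemma cnt_split (q : ℕ → Prop) :
    cnt n p = cnt n (fun x => p x ∧ q x) + cnt n (fun x => p x ∧ ¬ q x) := by
  classical
  unfold cnt
  have := card_filter_add_card_filter_not (s := {x ∈ Icc 1 n | p x}) q
  rw [filter_filter, filter_filter] at this
  convert this.symm

lemma cnt_Ico {u v : ℕ} (hu : 1 ≤ u) (hv : v ≤ n + 1) :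
    cnt n (fun x => u ≤ x ∧ x < v) = v - u := by
  classical
  unfold cnt
  rw [← Nat.card_Ico]
  congr 1
  ext x
  simp only [mem_filter, mem_Icc, mem_Ico]
  omega

lemma exists_not_of_cnt_lt {u v : ℕ} (hu : 1 ≤ u) (hv : v ≤ n + 1) (h : cnt n p < v - u) :
    ∃ x, u ≤ x ∧ x < v ∧ ¬ p x := by
  by_contra! hc
  rw [← cnt_Ico hu hv] at h
  exact absurd (cnt_mono fun x _ _ hx => hc x hx.1 hx.2) (not_le.2 h)

lemma cnt_mem {S : Finset ℕ} (hS : S ⊆ Icc 1 n) : cnt n (· ∈ S) = #S := by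
  classical
  unfold cnt
  congr 1
  ext x
  simpa using fun hx => mem_Icc.1 (hS hx)

lemma cnt_symmDiff {S T : Finset ℕ} (hS : S ⊆ Icc 1 n) (hT : T ⊆ Icc 1 n) :
    #(symmDiff S T) = cnt n (fun x => ¬ (x ∈ S ↔ x ∈ T)) := by
  classical
  unfold cnt
  congr 1
  ext x
  have h1 := @hS x
  have h2 := @hT x
  simp only [mem_symmDiff, mem_filter]
  tauto

end Counting

/-- `B ⊆ D ⊆ A ⊆ [n]` where every element of `B` lies in few Schur triples of the given kinds,
and `#B + #D` is nearly `n`. -/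
structure NearSumFree (n E : ℕ) (A B D : Finset ℕ) : Prop where
  pos : 1 ≤ E
  subset_D : B ⊆ D
  subset_A : D ⊆ A
  subset_Icc : A ⊆ Icc 1 n
  sum_le : ∀ b ∈ B, cnt n (fun x => x ∈ A ∧ x < b ∧ b - x ∈ D) ≤ E
  diff_le : ∀ b ∈ B, cnt n (fun x => x ∈ D ∧ x + b ∈ D) ≤ E
  card_ge : n ≤ #B + #D + E

namespace NearSumFree

variable {n E : ℕ} {A B D : Finset ℕ}

lemma mem_D_bounds (h : NearSumFree n E A B D) {x : ℕ} (hx : x ∈ D) : 1 ≤ x ∧ x ≤ n :=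
  mem_Icc.1 (h.subset_Icc (h.subset_A hx))

lemma mem_B_bounds (h : NearSumFree n E A B D) {x : ℕ} (hx : x ∈ B) : 1 ≤ x ∧ x ≤ n :=
  h.mem_D_bounds (h.subset_D hx)

/-- Below `N = max B`, few elements of `D` are outside `B` and few pairs `{x, N - x}` avoid `D`;
above `N`, few elements are outside `D`. -/
lemma basic (h : NearSumFree n E A B D) {N : ℕ} (hN : N ∈ B) (hmax : ∀ b ∈ B, b ≤ N) :
    cnt n (fun x => (x < N ∧ x ∈ D) ∧ x ∉ B) + cnt n (fun x => N < x ∧ x ∉ D) +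
      cnt n (fun x => (x < N ∧ x ∉ D) ∧ N - x ∉ D) ≤ 3 * E ∧
    N ≤ 2 * cnt n (fun x => x < N ∧ x ∈ D) + 1 + 3 * E := by
  have hNn := h.mem_B_bounds hN
  have hE := h.pos
  have hT : cnt n (fun x => (x < N ∧ N - x ∈ D) ∧ x ∈ D) ≤ E := by
    refine le_trans (cnt_mono ?_) (h.sum_le N hN)
    rintro x - - ⟨⟨h1, h2⟩, h3⟩
    exact ⟨h.subset_A h3, h1, h2⟩
  have hlt : cnt n (fun x => x < N) = N - 1 := by
    rw [← cnt_Ico (n := n) (u := 1) (v := N) le_rfl (by omega)]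
    exact cnt_congr fun x h1 _ => by simp [h1]
  have hgt : cnt n (fun x => N < x) = n - N := by
    have := cnt_Ico (n := n) (u := N + 1) (v := n + 1) (by omega) le_rfl
    rw [show n - N = n + 1 - (N + 1) by omega, ← this]
    exact cnt_congr fun x _ h2 => by omega
  have e1 := cnt_split (n := n) (p := fun x => x < N) (· ∈ D)
  have e2 := cnt_split (n := n) (p := fun x => x < N ∧ x ∉ D) (fun x => N - x ∈ D)
  have e3 : cnt n (fun x => x < N ∧ N - x ∈ D) = cnt n (fun x => x < N ∧ x ∈ D) := by
    refine le_antisymm (cnt_map (fun x => N - x) ?_ ?_) (cnt_map (fun x => N - x) ?_ ?_)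
    · rintro x h1 h2 ⟨h3, h4⟩
      exact ⟨by omega, by omega, by omega, h4⟩
    · rintro x y ⟨h1, -⟩ ⟨h2, -⟩ h3
      omega
    · rintro x h1 h2 ⟨h3, h4⟩
      refine ⟨by omega, by omega, by omega, ?_⟩
      rwa [show N - (N - x) = x by omega]
    · rintro x y ⟨h1, -⟩ ⟨h2, -⟩ h3
      omega
  have e4 := cnt_split (n := n) (p := fun x => x < N ∧ N - x ∈ D) (· ∈ D)
  have e5 : cnt n (fun x => (x < N ∧ N - x ∈ D) ∧ x ∉ D) =
      cnt n (fun x => (x < N ∧ x ∉ D) ∧ N - x ∈ D) := cnt_congr fun x _ _ => by tauto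
  have e6 := cnt_split (n := n) (p := fun x => x < N ∧ x ∈ D) (· ∈ B)
  have e7 := cnt_split (n := n) (p := fun x => N < x) (· ∈ D)
  have hone : cnt n (fun x => x = N) = 1 := by
    have := cnt_Ico (n := n) (u := N) (v := N + 1) (by omega) (by omega)
    rw [show N + 1 - N = 1 by omega] at this
    rw [← this]
    exact cnt_congr fun x _ _ => by omega
  have hB : #B ≤ 1 + cnt n (fun x => (x < N ∧ x ∈ D) ∧ x ∈ B) := by
    rw [← hone, ← cnt_mem (h.subset_D.trans (h.subset_A.trans h.subset_Icc))]
    refine cnt_le_add fun x _ _ hx => ?_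
    rcases (hmax x hx).lt_or_eq with hl | hl
    · exact Or.inr ⟨⟨hl, h.subset_D hx⟩, hx⟩
    · exact Or.inl hl
  have hD : #D ≤ 1 + (cnt n (fun x => x < N ∧ x ∈ D) + cnt n (fun x => N < x ∧ x ∈ D)) := by
    rw [← hone, ← cnt_mem (h.subset_A.trans h.subset_Icc)]
    refine (cnt_le_add (q := fun x => x = N) (r := fun x => x ≠ N ∧ x ∈ D) fun x _ _ hx => by
      tauto).trans (Nat.add_le_add_left (cnt_le_add fun x _ _ hx => ?_) _)
    rcases lt_or_gt_of_ne hx.1 with hl | hl <;> tauto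
  have := h.card_ge
  constructor <;> omega

lemma cnt_notMem_B (h : NearSumFree n E A B D) {N : ℕ} (hN : N ∈ B) (hmax : ∀ b ∈ B, b ≤ N) :
    cnt n (fun x => (x < N ∧ x ∈ D) ∧ x ∉ B) ≤ 3 * E := by
  have := (h.basic hN hmax).1
  omega

lemma cnt_pair_notMem (h : NearSumFree n E A B D) {N : ℕ} (hN : N ∈ B)
    (hmax : ∀ b ∈ B, b ≤ N) : cnt n (fun x => (x < N ∧ x ∉ D) ∧ N - x ∉ D) ≤ 3 * E := by
  have := (h.basic hN hmax).1
  omega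

/-- Shifting by an element of `B` exchanges `D` and its complement below `N`. -/
lemma cnt_shift (h : NearSumFree n E A B D) {N : ℕ} (hN : N ∈ B) (hmax : ∀ b ∈ B, b ≤ N)
    {b : ℕ} (hb : b ∈ B) : cnt n (fun x => x + b < N ∧ (x ∈ D ↔ x + b ∈ D)) ≤ 8 * E := by
  have hNn := h.mem_B_bounds hN
  have hb1 := h.mem_B_bounds hb
  have hZ := h.cnt_pair_notMem hN hmax
  have hZ' : cnt n (fun x => x + b < N ∧ x + b ∉ D ∧ N - (x + b) ∉ D) ≤ 3 * E := by
    refine le_trans (cnt_map (fun x => x + b) ?_ ?_) hZ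
    · rintro x h1 h2 ⟨h3, h4, h5⟩
      exact ⟨by omega, by omega, ⟨h3, h4⟩, h5⟩
    · intro x y _ _ hxy
      exact Nat.add_right_cancel hxy
  have hd : cnt n (fun x => x + b < N ∧ N - (x + b) ∈ D ∧ N - x ∈ D) ≤ E := by
    refine le_trans (cnt_map (fun x => N - (x + b)) ?_ ?_) (h.diff_le b hb)
    · rintro x h1 h2 ⟨h3, h4, h5⟩
      refine ⟨by omega, by omega, h4, ?_⟩
      rwa [show N - (x + b) + b = N - x by omega]
    · intro x y hx hy hxy
      have := hx.1
      have := hy.1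
      omega
  have hs := h.diff_le b hb
  have c1 : cnt n (fun x => x + b < N ∧ (x ∈ D ↔ x + b ∈ D)) ≤ cnt n (fun x => x ∈ D ∧ x + b ∈ D) +
      cnt n (fun x => x + b < N ∧ x ∉ D ∧ x + b ∉ D) := cnt_le_add fun x _ _ hx => by tauto
  have c2 : cnt n (fun x => x + b < N ∧ x ∉ D ∧ x + b ∉ D) ≤
      cnt n (fun x => (x < N ∧ x ∉ D) ∧ N - x ∉ D) +
        cnt n (fun x => x + b < N ∧ x + b ∉ D ∧ N - x ∈ D) := by
    refine cnt_le_add fun x _ _ hx => ?_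
    have : x < N := by omega
    tauto
  have c3 : cnt n (fun x => x + b < N ∧ x + b ∉ D ∧ N - x ∈ D) ≤
      cnt n (fun x => x + b < N ∧ x + b ∉ D ∧ N - (x + b) ∉ D) +
        cnt n (fun x => x + b < N ∧ N - (x + b) ∈ D ∧ N - x ∈ D) :=
    cnt_le_add fun x _ _ hx => by tauto
  omega

/-- The largest element of `B` is close to `n`. -/
lemma le_max_add (h : NearSumFree n E A B D) {N : ℕ} (hN : N ∈ B) (hmax : ∀ b ∈ B, b ≤ N) :
    n ≤ N + 18 * E := by
  by_contra! hc
  have hNn := h.mem_B_bounds hN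
  have hE := h.pos
  have hU : cnt n (fun x => N < x ∧ x ∉ D) ≤ 3 * E := by
    have := (h.basic hN hmax).1
    omega
  obtain ⟨a, ha, hmin⟩ : ∃ a ∈ B, ∀ b ∈ B, a ≤ b :=
    ⟨B.min' ⟨N, hN⟩, min'_mem _ _, fun b hb => min'_le _ _ hb⟩
  have ha1 := h.mem_B_bounds ha
  have haN := hmax a ha
  have hUa : cnt n (fun x => N < x + a ∧ x + a ≤ n ∧ x + a ∉ D) ≤ 3 * E := by
    refine le_trans (cnt_map (fun x => x + a) ?_ ?_) hU
    · rintro x h1 h2 ⟨h3, h4, h5⟩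
      exact ⟨by omega, by omega, h3, h5⟩
    · intro x y _ _ hxy
      exact Nat.add_right_cancel hxy
  have hd := h.diff_le a ha
  have hlow : n ≤ N + a + 7 * E := by
    by_contra! hlt
    have c1 : cnt n (fun x => N < x ∧ x + a ≤ n) ≤ cnt n (fun x => N < x ∧ x ∉ D) +
        cnt n (fun x => N < x + a ∧ x + a ≤ n ∧ x ∈ D) := cnt_le_add fun x _ _ hx => by
      have : N < x + a := by omega
      tauto
    have c2 : cnt n (fun x => N < x + a ∧ x + a ≤ n ∧ x ∈ D) ≤
        cnt n (fun x => N < x + a ∧ x + a ≤ n ∧ x + a ∉ D) +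
          cnt n (fun x => x ∈ D ∧ x + a ∈ D) := cnt_le_add fun x _ _ hx => by tauto
    have c3 : cnt n (fun x => N < x ∧ x + a ≤ n) = n - N - a := by
      rw [show n - N - a = (n + 1 - a) - (N + 1) by omega,
        ← cnt_Ico (n := n) (u := N + 1) (v := n + 1 - a) (by omega) (by omega)]
      exact cnt_congr fun x _ _ => by omega
    omega
  obtain ⟨l, hla, hln, hl⟩ : ∃ l, l ≤ a ∧ N + l ≤ n ∧ l = 11 * E + 1 :=
    ⟨11 * E + 1, by omega, by omega, rfl⟩
  have c1 : cnt n (fun x => N < x + a ∧ x < N ∧ x + a ≤ N + l) ≤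
      cnt n (fun x => N < x + a ∧ x + a ≤ n ∧ x + a ∉ D) +
        cnt n (fun x => N < x + a ∧ x < N ∧ x + a ∈ D) := cnt_le_add fun x _ _ hx => by
    have : x + a ≤ n := by omega
    tauto
  have c2 : cnt n (fun x => N < x + a ∧ x < N ∧ x + a ∈ D) ≤
      cnt n (fun x => x ∈ D ∧ x + a ∈ D) + cnt n (fun x => N < x + a ∧ x < N ∧ x ∉ D) :=
    cnt_le_add fun x _ _ hx => by tauto
  have c3 : cnt n (fun x => N < x + a ∧ x < N ∧ x ∉ D) ≤
      cnt n (fun x => (x < N ∧ x ∉ D) ∧ N - x ∉ D) +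
        cnt n (fun x => N < x + a ∧ x < N ∧ N - x ∈ D) :=
    cnt_le_add fun x _ _ hx => by tauto
  have c4 : cnt n (fun x => N < x + a ∧ x < N ∧ N - x ∈ D) ≤
      cnt n (fun x => (x < N ∧ x ∈ D) ∧ x ∉ B) := by
    refine cnt_map (fun x => N - x) ?_ ?_
    · rintro x h1 h2 ⟨h3, h4, h5⟩
      refine ⟨by omega, by omega, ⟨by omega, h5⟩, fun hB => ?_⟩
      have := hmin _ hB
      omega
    · intro x y hx hy hxy
      omega
  have c5 : cnt n (fun x => N < x + a ∧ x < N ∧ x + a ≤ N + l) ≥ l - 1 := by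
    have := cnt_Ico (n := n) (u := N - a + 1) (v := min N (N + l - a + 1)) (by omega) (by omega)
    refine le_trans (by omega) (this.symm.le.trans (cnt_mono fun x _ _ hx => by omega))
  have := (h.basic hN hmax).1
  omega

/-- Few elements of `A` are outside `D`. -/
lemma cnt_mem_A_notMem_D (h : NearSumFree n E A B D) (hB : B.Nonempty) :
    cnt n (fun x => x ∈ A ∧ x ∉ D) ≤ 23 * E := by
  obtain ⟨N, hN, hmax⟩ : ∃ a ∈ B, ∀ b ∈ B, b ≤ a :=
    ⟨B.max' hB, max'_mem _ _, fun b hb => le_max' _ _ hb⟩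
  have hNn := h.mem_B_bounds hN
  have hE := h.pos
  have hm := h.le_max_add hN hmax
  have c1 : cnt n (fun x => x ∈ A ∧ x ∉ D) ≤ cnt n (fun x => (x ∈ A ∧ x ∉ D) ∧ x < N) +
      cnt n (fun x => N ≤ x ∧ x < n + 1) := cnt_le_add fun x _ _ hx => by
    rcases lt_or_ge x N with h1 | h1
    · tauto
    · exact Or.inr (by omega)
  have c2 : cnt n (fun x => (x ∈ A ∧ x ∉ D) ∧ x < N) ≤ 
      cnt n (fun x => x ∈ A ∧ x < N ∧ N - x ∈ D) +
      cnt n (fun x => (x < N ∧ x ∉ D) ∧ N - x ∉ D) := cnt_le_add fun x _ _ hx => by tauto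
  rw [cnt_Ico (by omega) le_rfl] at c1
  have := h.sum_le N hN
  have := h.cnt_pair_notMem hN hmax
  omega

set_option maxHeartbeats 1000000 in
/-- If `B` has a small element, then `D` is close to the odd numbers. -/
lemma cnt_odd (h : NearSumFree n E A B D) {N : ℕ} (hN : N ∈ B) (hmax : ∀ b ∈ B, b ≤ N)
    {t a : ℕ} (ht : 100 * E ≤ t) (hn : 100 * t ≤ n) (ha : a ∈ B) (hat : a ≤ t) :
    cnt n (fun x => ¬ (x ∈ D ↔ Odd x)) ≤ 3 * t + 33 * E := by
  have aux₁ : ∀ p r q s₁ s₂ : Prop, ¬ ((p ↔ r) ↔ (s₁ ↔ s₂)) →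
      ¬ ((q ↔ r) ↔ s₂) ∨ ¬ ((q ↔ p) ↔ s₁) := by tauto
  have aux₂ : ∀ p q r s s₁ s₂ : Prop, ((p ↔ r) ↔ s) → ((q ↔ r) ↔ s₂) → ((q ↔ p) ↔ s₁) →
      (s₂ ↔ (s ↔ s₁)) := by tauto
  have hNn := h.mem_B_bounds hN
  have hE := h.pos
  have hm := h.le_max_add hN hmax
  have ha1 := h.mem_B_bounds ha
  set H : ℕ → Prop := fun x => x ∈ B ∨ (x ∉ D ∧ x + a ∈ B) with hH
  have hHbad : cnt n (fun x => x + a < N ∧ ¬ H x) ≤ 14 * E := by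
    have c1 : cnt n (fun x => x + a < N ∧ ¬ H x) ≤ cnt n (fun x => (x < N ∧ x ∈ D) ∧ x ∉ B) +
        cnt n (fun x => x + a < N ∧ x ∉ D ∧ x + a ∉ B) := cnt_le_add fun x _ _ hx => by
      have : x < N := by omega
      simp only [hH] at hx
      tauto
    have c2 : cnt n (fun x => x + a < N ∧ x ∉ D ∧ x + a ∉ B) ≤
        cnt n (fun x => x + a < N ∧ (x ∈ D ↔ x + a ∈ D)) +
        cnt n (fun x => x + a < N ∧ x + a ∈ D ∧ x + a ∉ B) := cnt_le_add fun x _ _ hx => by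
      tauto
    have c3 : cnt n (fun x => x + a < N ∧ x + a ∈ D ∧ x + a ∉ B) ≤
        cnt n (fun x => (x < N ∧ x ∈ D) ∧ x ∉ B) := by
      refine cnt_map (fun x => x + a) ?_ ?_
      · rintro x h1 h2 ⟨h3, h4, h5⟩
        exact ⟨by omega, by omega, ⟨h3, h4⟩, h5⟩
      · intro x y _ _ hxy
        exact Nat.add_right_cancel hxy
    have := h.cnt_notMem_B hN hmax
    have := h.cnt_shift hN hmax ha
    omega
  have hHgood : ∀ k, H k → cnt n (fun x => x + k + t < N ∧ ¬ ((x + k ∈ D ↔ x ∈ D) ↔ k ∉ D))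
      ≤ 16 * E := by
    rintro k (hk | ⟨hkD, hk⟩)
    · have hkD := h.subset_D hk
      refine le_trans (cnt_mono ?_) ((h.cnt_shift hN hmax hk).trans (by omega))
      intro x _ _ hx
      refine ⟨by omega, ?_⟩
      tauto
    · have c1 : cnt n (fun x => x + k + t < N ∧ ¬ ((x + k ∈ D ↔ x ∈ D) ↔ k ∉ D)) ≤
          cnt n (fun x => x + (k + a) < N ∧ (x ∈ D ↔ x + (k + a) ∈ D)) +
          cnt n (fun x => x + k + a < N ∧ (x + k ∈ D ↔ x + k + a ∈ D)) :=
        cnt_le_add fun x _ _ hx => by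
          have h1 : x + k + a < N := by omega
          rw [← add_assoc]
          tauto
      have c2 : cnt n (fun x => x + k + a < N ∧ (x + k ∈ D ↔ x + k + a ∈ D)) ≤
          cnt n (fun x => x + a < N ∧ (x ∈ D ↔ x + a ∈ D)) := by
        refine cnt_map (fun x => x + k) ?_ ?_
        · rintro x h1 h2 ⟨h3, h4⟩
          exact ⟨by omega, by omega, h3, h4⟩
        · intro x y _ _ hxy
          exact Nat.add_right_cancel hxy
      have := h.cnt_shift hN hmax ha
      have := h.cnt_shift hN hmax hk
      omega
  set G : ℕ → Prop → Prop := fun k s =>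
    cnt n (fun x => x + k + 2 * t < N ∧ ¬ ((x + k ∈ D ↔ x ∈ D) ↔ s)) ≤ 32 * E with hG
  have hshift : ∀ (p : ℕ → Prop) (k : ℕ) (l : ℕ), 
      cnt n (fun x => x + k + l < N ∧ p (x + k)) ≤ cnt n (fun x => x + l < N ∧ p x) := by
    intro p k l
    refine cnt_map (fun x => x + k) ?_ ?_
    · rintro x h1 h2 ⟨h3, h4⟩
      exact ⟨by omega, by omega, h3, h4⟩
    · intro x y _ _ hxy
      exact Nat.add_right_cancel hxy
  have hGex : ∀ k, k + 2 * t < N → ∃ s, G k s := by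
    intro k hk
    have c1 := hshift (fun x => ¬ H x) k a
    obtain ⟨k', hk1, hk2, hk3⟩ := exists_not_of_cnt_lt (n := n) (u := 1) (v := t + 1)
      (p := fun x => (x + a < N ∧ ¬ H x) ∨ (x + k + a < N ∧ ¬ H (x + k))) le_rfl (by omega)
      (lt_of_le_of_lt (cnt_le_add fun x _ _ hx => hx) (by omega))
    have h1 : k' + a < N := by omega
    have h2 : k' + k + a < N := by omega
    simp only [not_or, not_and, not_not] at hk3
    have g1 := hHgood k' (hk3.1 h1)
    have g2 := hHgood (k' + k) (hk3.2 h2)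
    refine ⟨(k' ∉ D ↔ k' + k ∉ D), ?_⟩
    have c2 := hshift (fun x => ¬ ((x + k' ∈ D ↔ x ∈ D) ↔ k' ∉ D)) k (k' + t)
    have c3 : cnt n (fun x => x + k + 2 * t < N ∧
        ¬ ((x + k ∈ D ↔ x ∈ D) ↔ (k' ∉ D ↔ k' + k ∉ D))) ≤
        cnt n (fun x => x + (k' + k) + t < N ∧
          ¬ ((x + (k' + k) ∈ D ↔ x ∈ D) ↔ k' + k ∉ D)) +
        cnt n (fun x => x + k + (k' + t) < N ∧
          ¬ ((x + k + k' ∈ D ↔ x + k ∈ D) ↔ k' ∉ D)) := cnt_le_add fun x _ _ hx => by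
      have h3 : x + (k' + k) + t < N := by omega
      have h4 : x + k + (k' + t) < N := by omega
      have h5 : x + k + k' = x + (k' + k) := by omega
      rw [h5]
      rcases aux₁ _ _ (x + (k' + k) ∈ D) _ _ hx.2 with h6 | h6
      · exact Or.inl ⟨h3, h6⟩
      · exact Or.inr ⟨h4, h6⟩
    simp only [← add_assoc] at c2 c3 g1 g2
    simp only [hG]
    omega
  have hHG : ∀ k, H k → G k (k ∉ D) := fun k hk => by
    refine le_trans (cnt_mono fun x _ _ hx => ?_) ((hHgood k hk).trans (by omega))
    exact ⟨by omega, hx.2⟩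
  have hGuniq : ∀ k s s', k + 3 * t < N → G k s → G k s' → (s ↔ s') := by
    intro k s s' hk g1 g2
    obtain ⟨x, hx1, hx2, hx3⟩ := exists_not_of_cnt_lt (n := n) (u := 1) (v := t)
      (p := fun x => (x + k + 2 * t < N ∧ ¬ ((x + k ∈ D ↔ x ∈ D) ↔ s)) ∨
        (x + k + 2 * t < N ∧ ¬ ((x + k ∈ D ↔ x ∈ D) ↔ s'))) le_rfl (by omega)
      (lt_of_le_of_lt ((cnt_le_add fun x _ _ hx => hx).trans (add_le_add g1 g2)) (by omega))
    simp only [not_or, not_and, not_not] at hx3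
    exact (hx3.1 (by omega)).symm.trans (hx3.2 (by omega))
  have hGmul : ∀ k s s₁ s₂, k + 3 * t < N → G k s → G 1 s₁ → G (k + 1) s₂ →
      (s₂ ↔ (s ↔ s₁)) := by
    intro k s s₁ s₂ hk g1 g2 g3
    have g2' := (hshift (fun x => ¬ ((x + 1 ∈ D ↔ x ∈ D) ↔ s₁)) k (1 + 2 * t)).trans
      (by simpa only [← add_assoc] using g2)
    obtain ⟨x, hx1, hx2, hx3⟩ := exists_not_of_cnt_lt (n := n) (u := 1) (v := t)
      (p := fun x => ((x + k + 2 * t < N ∧ ¬ ((x + k ∈ D ↔ x ∈ D) ↔ s)) ∨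
        (x + (k + 1) + 2 * t < N ∧ ¬ ((x + (k + 1) ∈ D ↔ x ∈ D) ↔ s₂))) ∨
        (x + k + (1 + 2 * t) < N ∧ ¬ ((x + k + 1 ∈ D ↔ x + k ∈ D) ↔ s₁))) le_rfl (by omega)
      (lt_of_le_of_lt ((cnt_le_add fun x _ _ hx => hx).trans (add_le_add
        ((cnt_le_add fun x _ _ hx => hx).trans (add_le_add g1 g3)) g2')) (by omega))
    have h1 : x + k + 2 * t < N := by omega
    have h3 : x + k + (1 + 2 * t) < N := by omega
    simp only [not_or, not_and, not_not] at hx3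
    rw [← add_assoc] at hx3
    exact aux₂ _ _ _ _ _ _ (hx3.1.1 h1) (hx3.1.2 (by omega)) (hx3.2 h3)
  obtain ⟨s, hs⟩ := hGex 1 (by omega)
  have hGall : ∀ k, 1 ≤ k → k + 3 * t ≤ N → G k (s ∨ Even k) := by
    intro k hk
    induction k, hk using Nat.le_induction with
    | base => intro _; simpa using hs
    | succ k hk ih =>
      intro hkN
      obtain ⟨s₂, hs₂⟩ := hGex (k + 1) (by omega)
      have := hGmul k _ _ _ (by omega) (ih (by omega)) hs hs₂
      have h2 : s₂ ↔ s ∨ Even (k + 1) := by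
        rw [this, Nat.even_add_one]
        tauto
      rwa [← propext h2]
  have hHs : ∀ k, 1 ≤ k → k + 3 * t < N → H k → (k ∉ D ↔ s ∨ Even k) := fun k hk1 hk2 hk =>
    hGuniq k _ _ hk2 (hHG k hk) (hGall k hk1 hk2.le)
  have hend : cnt n (fun x => N - 3 * t ≤ x ∧ x < n + 1) ≤ 3 * t + 18 * E + 1 := by
    rw [cnt_Ico (by omega) le_rfl]
    omega
  have hs' : ¬ s := by
    intro hs1
    have c1 : cnt n (fun x => x < N ∧ x ∈ D) ≤ cnt n (fun x => x + a < N ∧ ¬ H x) +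
        cnt n (fun x => N - 3 * t ≤ x ∧ x < n + 1) := cnt_le_add fun x h1 h2 hx => by
      by_cases hx2 : N - 3 * t ≤ x
      · right; omega
      · left
        refine ⟨by omega, fun hk => ?_⟩
        exact (hHs x h1 (by omega) hk).2 (Or.inl hs1) hx.2
    have := (h.basic hN hmax).2
    omega
  have c1 : cnt n (fun x => ¬ (x ∈ D ↔ Odd x)) ≤ 
      cnt n (fun x => x + a < N ∧ ¬ H x) +
        cnt n (fun x => N - 3 * t ≤ x ∧ x < n + 1) := cnt_le_add fun x h1 h2 hx => by
      by_cases hx2 : N - 3 * t ≤ x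
      · right; omega
      · left
        refine ⟨by omega, fun hk => ?_⟩
        have := hHs x h1 (by omega) hk
        rw [← Nat.not_even_iff_odd] at hx
        exact hx (by rw [← not_iff_not, not_not, this, or_iff_right hs'])
  omega

set_option maxHeartbeats 1000000 in
/-- If `B` has no small element, then all its elements are nearly at least `N / 2`. -/
lemma max_le_two_mul_min (h : NearSumFree n E A B D) {N : ℕ} (hN : N ∈ B)
    (hmax : ∀ b ∈ B, b ≤ N) {t a : ℕ} (ht : 100 * E ≤ t) (hn : 100 * t ≤ n) (ha : a ∈ B)
    (hmin : ∀ b ∈ B, a ≤ b) (hat : t < a) : N ≤ 2 * a + 2 * t := by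
  by_contra! hc
  have hNn := h.mem_B_bounds hN
  have hE := h.pos
  have hm := h.le_max_add hN hmax
  have ha1 := h.mem_B_bounds ha
  have hW := h.cnt_notMem_B hN hmax
  have hZ := h.cnt_pair_notMem hN hmax
  have hR := h.cnt_shift hN hmax ha
  have hshift : ∀ (p : ℕ → Prop) (k : ℕ), 
      cnt n (fun x => k < x ∧ x < N ∧ p (x - k)) ≤ cnt n (fun x => x + k < N ∧ p x) := by
    intro p k
    refine cnt_map (fun x => x - k) ?_ ?_
    · rintro x h1 h2 ⟨h3, h4, h5⟩
      exact ⟨by omega, by omega, by omega, h5⟩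
    · intro x y hx hy hxy
      omega
  have i0 : cnt n (fun x => x < a ∧ x ∈ D) ≤ 3 * E := by
    refine le_trans (cnt_mono fun x _ _ hx => ?_) hW
    refine ⟨⟨by omega, hx.2⟩, fun hB => ?_⟩
    have := hmin _ hB
    omega
  have i1 : cnt n (fun x => (a < x ∧ x < 2 * a) ∧ x ∉ D) ≤ 11 * E := by
    have := hshift (fun x => (x ∈ D ↔ x + a ∈ D) ∨ (x < a ∧ x ∈ D)) a
    have c : cnt n (fun x => x + a < N ∧ ((x ∈ D ↔ x + a ∈ D) ∨ (x < a ∧ x ∈ D))) ≤ _ + _ :=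
      cnt_le_add (q := fun x => x + a < N ∧ (x ∈ D ↔ x + a ∈ D))
        (r := fun x => x < a ∧ x ∈ D) fun x _ _ hx => by tauto
    refine (cnt_mono fun x _ _ hx => ?_).trans (this.trans (c.trans (by omega)))
    have e : x - a + a = x := by omega
    have : x - a < a := by omega
    refine ⟨by omega, by omega, ?_⟩
    rw [e]
    tauto
  have i2 : cnt n (fun x => (2 * a < x ∧ x < 3 * a ∧ x < N) ∧ x ∈ D) ≤ 19 * E := by
    have := hshift (fun x => (x ∈ D ↔ x + a ∈ D) ∨ ((a < x ∧ x < 2 * a) ∧ x ∉ D)) a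
    have c : cnt n (fun x => x + a < N ∧
        ((x ∈ D ↔ x + a ∈ D) ∨ ((a < x ∧ x < 2 * a) ∧ x ∉ D))) ≤ _ + _ :=
      cnt_le_add (q := fun x => x + a < N ∧ (x ∈ D ↔ x + a ∈ D))
        (r := fun x => (a < x ∧ x < 2 * a) ∧ x ∉ D) fun x _ _ hx => by tauto
    refine (cnt_mono fun x _ _ hx => ?_).trans (this.trans (c.trans (by omega)))
    have e : x - a + a = x := by omega
    have : x - a < 2 * a := by omega
    have : a < x - a := by omega
    refine ⟨by omega, by omega, ?_⟩
    rw [e]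
    tauto
  have i3 : cnt n (fun x => (3 * a < x ∧ x < 4 * a ∧ x < N) ∧ x ∉ D) ≤ 27 * E := by
    have := hshift (fun x => (x ∈ D ↔ x + a ∈ D) ∨ ((2 * a < x ∧ x < 3 * a ∧ x < N) ∧ x ∈ D)) a
    have c : cnt n (fun x => x + a < N ∧
        ((x ∈ D ↔ x + a ∈ D) ∨ ((2 * a < x ∧ x < 3 * a ∧ x < N) ∧ x ∈ D))) ≤ _ + _ :=
      cnt_le_add (q := fun x => x + a < N ∧ (x ∈ D ↔ x + a ∈ D))
        (r := fun x => (2 * a < x ∧ x < 3 * a ∧ x < N) ∧ x ∈ D) fun x _ _ hx => by tauto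
    refine (cnt_mono fun x _ _ hx => ?_).trans (this.trans (c.trans (by omega)))
    have e : x - a + a = x := by omega
    have : x - a < 3 * a := by omega
    have : 2 * a < x - a := by omega
    have : x - a < N := by omega
    refine ⟨by omega, by omega, ?_⟩
    rw [e]
    tauto
  rcases le_or_gt (3 * a + t) N with h3 | h3
  · obtain ⟨b, hb1, hb2, hb3⟩ := exists_not_of_cnt_lt (n := n) (u := 2 * a - 20 * E) (v := 2 * a)
      (p := fun x => ((a < x ∧ x < 2 * a) ∧ x ∉ D) ∨ ((x < N ∧ x ∈ D) ∧ x ∉ B))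
      (by omega) (by omega)
      (lt_of_le_of_lt ((cnt_le_add fun x _ _ hx => hx).trans (add_le_add i1 hW)) (by omega))
    have hb : b ∈ B := by
      simp only [not_or, not_and, not_not] at hb3
      exact hb3.2 ⟨by omega, hb3.1 ⟨by omega, by omega⟩⟩
    have i3' : cnt n (fun x => (3 * a < x + b ∧ x + b < 4 * a ∧ x + b < N) ∧ x + b ∉ D) ≤
        27 * E := by
      refine le_trans (cnt_map (fun x => x + b) ?_ ?_) i3
      · rintro x h1 h2 ⟨h3, h4⟩
        exact ⟨by omega, by omega, h3, h4⟩
      · intro x y _ _ hxy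
        exact Nat.add_right_cancel hxy
    obtain ⟨x, hx1, hx2, hx3⟩ := exists_not_of_cnt_lt (n := n) (u := a + 20 * E + 1)
      (v := min (2 * a) (N - b))
      (p := fun x => (((a < x ∧ x < 2 * a) ∧ x ∉ D) ∨
        ((3 * a < x + b ∧ x + b < 4 * a ∧ x + b < N) ∧ x + b ∉ D)) ∨ (x ∈ D ∧ x + b ∈ D))
      (by omega) (by omega)
      (lt_of_le_of_lt ((cnt_le_add fun x _ _ hx => hx).trans (add_le_add
        ((cnt_le_add fun x _ _ hx => hx).trans (add_le_add i1 i3')) (h.diff_le b hb))) (by omega))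
    simp only [not_or, not_and, not_not] at hx3
    exact hx3.2 (hx3.1.1 ⟨by omega, by omega⟩) (hx3.1.2 ⟨by omega, by omega, by omega⟩)
  · have j : ∀ p : ℕ → Prop, cnt n (fun x => x < N ∧ p (N - x)) ≤ cnt n (fun x => p x) := by
      intro p
      refine cnt_map (fun x => N - x) ?_ ?_
      · rintro x h1 h2 ⟨h3, h4⟩
        exact ⟨by omega, by omega, h4⟩
      · rintro x y ⟨hx, -⟩ ⟨hy, -⟩ hxy
        omega
    have j1 := (j (fun x => x < a ∧ x ∈ D)).trans i0
    obtain ⟨x, hx1, hx2, hx3⟩ := exists_not_of_cnt_lt (n := n) (u := max (2 * a) (N - a) + 1)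
      (v := N - t)
      (p := fun x => (((2 * a < x ∧ x < 3 * a ∧ x < N) ∧ x ∈ D) ∨
        (x < N ∧ N - x < a ∧ N - x ∈ D)) ∨ ((x < N ∧ x ∉ D) ∧ N - x ∉ D))
      (by omega) (by omega)
      (lt_of_le_of_lt ((cnt_le_add fun x _ _ hx => hx).trans (add_le_add
        ((cnt_le_add fun x _ _ hx => hx).trans (add_le_add i2 j1)) hZ)) (by omega))
    simp only [not_or, not_and, not_not] at hx3
    exact hx3.1.2 (by omega) (by omega) (hx3.2 ⟨by omega, hx3.1.1 ⟨by omega, by omega, by omega⟩⟩)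

/-- If all elements of `B` are nearly at least `N / 2`, then `D` is close to `(n / 2, n]`. -/
lemma cnt_upper (h : NearSumFree n E A B D) {N : ℕ} (hN : N ∈ B)
    (hmax : ∀ b ∈ B, b ≤ N) {t a : ℕ} (ha : a ∈ B)
    (hmin : ∀ b ∈ B, a ≤ b) (hat : N ≤ 2 * a + 2 * t) :
    cnt n (fun x => ¬ (x ∈ D ↔ n / 2 + 1 ≤ x)) ≤ 2 * t + 50 * E := by
  have hNn := h.mem_B_bounds hN
  have hE := h.pos
  have hm := h.le_max_add hN hmax
  have ha1 := h.mem_B_bounds ha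
  have haN := hmax a ha
  have hW := h.cnt_notMem_B hN hmax
  have hZ := h.cnt_pair_notMem hN hmax
  have c1 : cnt n (fun x => x ∈ D ∧ x < n / 2 + 1) ≤
      cnt n (fun x => (x < N ∧ x ∈ D) ∧ x ∉ B) + cnt n (fun x => a ≤ x ∧ x < n / 2 + 1) :=
    cnt_le_add fun x _ _ hx => by
      rcases lt_or_ge x a with h1 | h1
      · left
        refine ⟨⟨by omega, hx.1⟩, fun hB => ?_⟩
        have := hmin _ hB
        omega
      · right; omega
  rw [cnt_Ico (u := a) (by omega) (by omega)] at c1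
  have c2 : cnt n (fun x => ¬ (x ∈ D ↔ n / 2 + 1 ≤ x)) ≤ cnt n (fun x => x ∈ D ∧ x < n / 2 + 1) +
      cnt n (fun x => n / 2 + 1 ≤ x ∧ x ∉ D) := cnt_le_add fun x _ _ hx => by
    rw [← not_le]
    tauto
  have c3 : cnt n (fun x => n / 2 + 1 ≤ x ∧ x ∉ D) ≤
      cnt n (fun x => N ≤ x ∧ x < n + 1) +
      cnt n (fun x => (n / 2 + 1 ≤ x ∧ x ∉ D) ∧ x < N) := cnt_le_add fun x _ _ hx => by
    rcases lt_or_ge x N with h1 | h1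
    · tauto
    · left; omega
  rw [cnt_Ico (u := N) (by omega) (by omega)] at c3
  have c4 : cnt n (fun x => (n / 2 + 1 ≤ x ∧ x ∉ D) ∧ x < N) ≤
      cnt n (fun x => (x < N ∧ x ∉ D) ∧ N - x ∉ D) +
      cnt n (fun x => n / 2 + 1 ≤ x ∧ x < N ∧ N - x ∈ D) := cnt_le_add fun x _ _ hx => by tauto
  have c5 : cnt n (fun x => n / 2 + 1 ≤ x ∧ x < N ∧ N - x ∈ D) ≤
      cnt n (fun x => x ∈ D ∧ x < n / 2 + 1) := by
    refine cnt_map (fun x => N - x) ?_ ?_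
    · rintro x h1 h2 ⟨h3, h4, h5⟩
      exact ⟨by omega, by omega, h5, by omega⟩
    · intro x y hx hy hxy
      omega
  omega

/-- Stability: `A` is close to the odd numbers or to the upper half of `[n]`. -/
theorem stability (h : NearSumFree n E A B D) (hB : B.Nonempty) {t : ℕ} (ht : 100 * E ≤ t)
    (hn : 100 * t ≤ n) :
    #(symmDiff A {x ∈ Icc 1 n | Odd x}) ≤ 4 * t ∨ #(symmDiff A (Icc (n / 2 + 1) n)) ≤ 4 * t := by
  obtain ⟨N, hN, hmax⟩ : ∃ a ∈ B, ∀ b ∈ B, b ≤ a :=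
    ⟨B.max' hB, max'_mem _ _, fun b hb => le_max' _ _ hb⟩
  obtain ⟨a, ha, hmin⟩ : ∃ a ∈ B, ∀ b ∈ B, a ≤ b :=
    ⟨B.min' hB, min'_mem _ _, fun b hb => min'_le _ _ hb⟩
  have hAD := h.cnt_mem_A_notMem_D hB
  have key : ∀ (T : Finset ℕ) (p : ℕ → Prop), T ⊆ Icc 1 n →
      (∀ x, 1 ≤ x → x ≤ n → (x ∈ T ↔ p x)) →
      #(symmDiff A T) ≤ cnt n (fun x => x ∈ A ∧ x ∉ D) + cnt n (fun x => ¬ (x ∈ D ↔ p x)) := by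
    intro T p hT hp
    rw [cnt_symmDiff h.subset_Icc hT]
    refine cnt_le_add fun x h1 h2 hx => ?_
    have := hp x h1 h2
    have := @h.subset_A x
    tauto
  rcases le_or_gt a t with hat | hat
  · left
    have := h.cnt_odd hN hmax ht hn ha hat
    refine (key _ Odd (filter_subset _ _) fun x h1 h2 => by simp [h1, h2]).trans (by omega)
  · right
    have := h.cnt_upper hN hmax ha hmin (h.max_le_two_mul_min hN hmax ht hn ha hmin hat)
    refine (key _ (fun x => n / 2 + 1 ≤ x) (Icc_subset_Icc_left (by omega))
      fun x h1 h2 => by simp [h2]).trans (by omega)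

end NearSumFree

/-- The coloured vertices `u, v, w` form a rainbow sum. -/
abbrev RainbowSum (u v w : ℕ × Fin 4) : Prop :=
  u.1 + v.1 = w.1 ∧ u.2 ≠ v.2 ∧ u.2 ≠ w.2 ∧ v.2 ≠ w.2

lemma boundedCodegree_rainbowSum : BoundedCodegree RainbowSum := by
  have key : ∀ (S : Finset (ℕ × Fin 4)) (x : ℕ), (∀ u ∈ S, u.1 = x) → #S ≤ 4 := by
    intro S x hS
    refine (card_le_card_of_injOn (t := univ) Prod.snd (fun _ _ => mem_univ _) ?_)
    intro u hu v hv h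
    exact Prod.ext ((hS u hu).trans (hS v hv).symm) h
  refine ⟨fun C v w => key _ (w.1 - v.1) ?_, fun C u w => key _ (w.1 - u.1) ?_,
    fun C u v => key _ (u.1 + v.1) ?_⟩ <;>
  · intro x hx
    have := (mem_filter.1 hx).2.1
    omega

/-- The colours which the set `C` of coloured vertices allows at `x`. -/
def palette (C : Finset (ℕ × Fin 4)) (x : ℕ) : Finset (Fin 4) := {a | (x, a) ∈ C}

lemma mem_palette {C : Finset (ℕ × Fin 4)} {x : ℕ} {a : Fin 4} :
    a ∈ palette C x ↔ (x, a) ∈ C := by simp [palette]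

/-- The graph of a colouring of `A`. -/
def coloringGraph (A : Finset ℕ) (f : A → Fin 4) : Finset (ℕ × Fin 4) :=
  univ.image fun x : A => (x.1, f x)

lemma coloringGraph_subset {A : Finset ℕ} {f : A → Fin 4} {C : Finset (ℕ × Fin 4)} :
    coloringGraph A f ⊆ C ↔ ∀ x : A, (x.1, f x) ∈ C := by
  simp [coloringGraph, image_subset_iff]

lemma coloringGraph_injective (A : Finset ℕ) : Function.Injective (coloringGraph A) := by
  intro f f' h
  funext x
  have := coloringGraph_subset.1 h.le x
  simp only [coloringGraph, mem_image, mem_univ, true_and, Prod.mk.injEq] at this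
  obtain ⟨y, hy, hfy⟩ := this
  rw [← hfy, Subtype.ext hy]

lemma card_coloringGraph_subset_le (A : Finset ℕ) (C : Finset (ℕ × Fin 4)) :
    #{f : A → Fin 4 | coloringGraph A f ⊆ C} ≤ ∏ x ∈ A, #(palette C x) := by
  rw [← prod_coe_sort A fun x => #(palette C x), ← Fintype.card_piFinset]
  refine card_le_card fun f hf => ?_
  simp only [mem_filter, mem_univ, true_and, coloringGraph_subset] at hf
  exact Fintype.mem_piFinset.2 fun x => mem_palette.2 (hf x)

/-- A container statement for rainbow sum-free colourings. -/
lemma numRSF_le_of_container {n g s t k : ℕ} {A : Finset ℕ} (hA : A ⊆ Icc 1 n) (hn : 0 < n)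
    (hs : 0 < s) (ht : 0 < t) (hgs : 8 * s ≤ g) (htg : 8 * t * (4 * n) ≤ s * g)
    (hts : 4 * n ≤ t * s) (hk : 64 * (4 * n) ≤ k * g) :
    ∃ C : Finset (ℕ × Fin 4), #(hyperedges RainbowSum C) < 2 * g * (4 * n) ∧
      numRSF 4 A ≤ (#{S ∈ (A ×ˢ (univ : Finset (Fin 4))).powerset | #S ≤ s} ^ 2) ^ k *
        ∏ x ∈ A, #(palette C x) := by
  classical
  set 𝓖 : Finset (A → Fin 4) := {f | ∀ x y z : A, (x : ℕ) + (y : ℕ) = (z : ℕ) →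
      ¬(f x ≠ f y ∧ f x ≠ f z ∧ f y ≠ f z)} with h𝓖
  have hcard : numRSF 4 A = #𝓖 := by
    rw [numRSF, Nat.card_eq_fintype_card, Fintype.card_subtype]
  have hM : #(A ×ˢ (univ : Finset (Fin 4))) ≤ 4 * n := by
    have := card_le_card hA
    simp only [Nat.card_Icc] at this
    rw [card_product, card_univ, Fintype.card_fin]
    omega
  obtain ⟨C, -, hC, hcount⟩ := exists_container boundedCodegree_rainbowSum
    (𝓖.image (coloringGraph A)) (by
      rintro I hI u hu v hv w hw ⟨hsum, hcol⟩
      obtain ⟨f, hf, rfl⟩ := mem_image.1 hI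
      simp only [coloringGraph, mem_image, mem_univ, true_and] at hu hv hw
      obtain ⟨x, rfl⟩ := hu
      obtain ⟨y, rfl⟩ := hv
      obtain ⟨z, rfl⟩ := hw
      exact (mem_filter.1 hf).2 x y z hsum hcol)
    (by omega) hs ht hgs htg hts (card_pos.2 ⟨∅, by simp⟩) k _ hM le_rfl
    ((Nat.mul_le_mul_left _ hM).trans hk)
  refine ⟨C, hC, ?_⟩
  have hfull : {I ∈ 𝓖.image (coloringGraph A) | I ⊆ A ×ˢ (univ : Finset (Fin 4))} =
      𝓖.image (coloringGraph A) := by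
    refine filter_true_of_mem fun I hI => ?_
    obtain ⟨f, -, rfl⟩ := mem_image.1 hI
    exact coloringGraph_subset.2 fun x => mem_product.2 ⟨x.2, mem_univ _⟩
  rw [hfull, card_image_of_injective _ (coloringGraph_injective A), ← hcard] at hcount
  refine hcount.trans (Nat.mul_le_mul_left _ ?_)
  rw [filter_image, card_image_of_injective _ (coloringGraph_injective A)]
  exact (card_le_card (filter_subset_filter _ (subset_univ _))).trans
    (card_coloringGraph_subset_le A C)

lemma prod_card_palette_le (A : Finset ℕ) (C : Finset (ℕ × Fin 4)) :
    ∏ x ∈ A, #(palette C x) ≤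
      2 ^ (#{x ∈ A | 3 ≤ #(palette C x)} + #{x ∈ A | 2 ≤ #(palette C x)}) := by
  rw [card_filter, card_filter, ← sum_add_distrib, ← prod_pow_eq_pow_sum]
  refine prod_le_prod' fun x _ => ?_
  have : #(palette C x) ≤ 4 := (card_le_univ _).trans (by simp)
  interval_cases #(palette C x) <;> simp

/-- Sets of sizes at least 1, 2, 3 have pairwise distinct representatives. -/
lemma exists_pairwise_ne {α : Type*} [DecidableEq α] {P Q R : Finset α} (hP : 1 ≤ #P)
    (hQ : 2 ≤ #Q) (hR : 3 ≤ #R) : ∃ a ∈ P, ∃ b ∈ Q, ∃ c ∈ R, a ≠ b ∧ a ≠ c ∧ b ≠ c := by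
  obtain ⟨a, ha⟩ := card_pos.1 hP
  obtain ⟨b, hb, hba⟩ := exists_mem_ne hQ a
  obtain ⟨c, hc, hcab⟩ := exists_mem_notMem_of_card_lt_card
    (lt_of_le_of_lt (card_le_two (a := a) (b := b)) hR)
  simp only [mem_insert, mem_singleton, not_or] at hcab
  exact ⟨a, ha, b, hb, c, hc, hba.symm, Ne.symm hcab.1, Ne.symm hcab.2⟩

lemma card_mul_le_card_of_cnt {α : Type*} {n E : ℕ} {S : Finset ℕ} {p : ℕ → ℕ → Prop}
    {T : Finset α} (φ : α → ℕ × ℕ) (hS : ∀ b ∈ S, E ≤ cnt n (p b))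
    (hT : ∀ b ∈ S, ∀ x, p b x → ∃ e ∈ T, φ e = (b, x)) : #S * E ≤ #T := by
  classical
  calc #S * E ≤ #(S.sigma fun b => {x ∈ Icc 1 n | p b x}) := by
        rw [card_sigma, ← smul_eq_mul]
        refine card_nsmul_le_sum _ _ _ fun b hb => ?_
        have := hS b hb
        rw [cnt] at this
        convert this
    _ = #((S.sigma fun b => {x ∈ Icc 1 n | p b x}).image fun y => (y.1, y.2)) := by
        rw [card_image_of_injective]
        rintro ⟨x, y⟩ ⟨x', y'⟩ h
        simpa using h
    _ ≤ #(T.image φ) := by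
        refine card_le_card fun y hy => ?_
        simp only [mem_image, mem_sigma, mem_filter] at hy ⊢
        obtain ⟨z, hz, rfl⟩ := hy
        exact hT _ hz.1 _ hz.2.2
    _ ≤ #T := card_image_le

/-- If `C` spans few rainbow sums, then after deleting few vertices the sets of elements with at
least 3 and at least 2 allowed colours have few Schur triples with each other and with `A`. -/
lemma exists_nearSumFree {n E h : ℕ} {A : Finset ℕ} {C : Finset (ℕ × Fin 4)} (hE : 1 ≤ E)
    (hA : A ⊆ Icc 1 n) (hC : #(hyperedges RainbowSum C) ≤ h)
    (hpos : ∀ x ∈ A, 1 ≤ #(palette C x))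
    (hcard : ∀ m, m * E ≤ 2 * h →
      n + m ≤ #{x ∈ A | 3 ≤ #(palette C x)} + #{x ∈ A | 2 ≤ #(palette C x)} + E) :
    ∃ B D : Finset ℕ, NearSumFree n E A B D := by
  classical
  set B₀ := {x ∈ A | 3 ≤ #(palette C x)} with hB₀
  set D := {x ∈ A | 2 ≤ #(palette C x)} with hD
  set S₁ := {b ∈ B₀ | E < cnt n (fun x => x ∈ A ∧ x < b ∧ b - x ∈ D)} with hS₁
  set S₂ := {b ∈ B₀ | E < cnt n (fun x => x ∈ D ∧ x + b ∈ D)} with hS₂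
  have h₁ : #S₁ * E ≤ #(hyperedges RainbowSum C) := by
    refine card_mul_le_card_of_cnt (fun e => (e.2.2.1, e.1.1))
      (fun b hb => (mem_filter.1 hb).2.le) fun b hb x hx => ?_
    obtain ⟨hxA, hxb, hbx⟩ := hx
    obtain ⟨a₁, h1, a₂, h2, a₃, h3, hne⟩ := exists_pairwise_ne (hpos x hxA)
      (mem_filter.1 hbx).2 (mem_filter.1 (mem_filter.1 hb).1).2
    rw [mem_palette] at h1 h2 h3
    refine ⟨((x, a₁), (b - x, a₂), (b, a₃)), ?_, rfl⟩
    simp only [hyperedges, mem_filter, mem_product]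
    exact ⟨⟨h1, h2, h3⟩, by omega, hne⟩
  have h₂ : #S₂ * E ≤ #(hyperedges RainbowSum C) := by
    refine card_mul_le_card_of_cnt (fun e => (e.2.1.1, e.1.1))
      (fun b hb => (mem_filter.1 hb).2.le) fun b hb x hx => ?_
    obtain ⟨hxD, hxb⟩ := hx
    obtain ⟨a₁, h1, a₂, h2, a₃, h3, hne, hne', hne''⟩ := exists_pairwise_ne
      (hpos x (mem_filter.1 hxD).1) (mem_filter.1 hxb).2 (mem_filter.1 (mem_filter.1 hb).1).2
    rw [mem_palette] at h1 h2 h3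
    refine ⟨((x, a₁), (b, a₃), (x + b, a₂)), ?_, rfl⟩
    simp only [hyperedges, mem_filter, mem_product]
    exact ⟨⟨h1, h3, h2⟩, rfl, hne', hne, hne''.symm⟩
  have hm := hcard (#S₁ + #S₂) (by rw [add_mul]; omega)
  refine ⟨(B₀ \ S₁) \ S₂, D, hE, fun x hx => ?_, filter_subset _ _, hA, fun b hb => ?_,
    fun b hb => ?_, ?_⟩
  · have := mem_filter.1 (mem_sdiff.1 (mem_sdiff.1 hx).1).1
    exact mem_filter.2 ⟨this.1, by omega⟩
  · have := mem_sdiff.1 (mem_sdiff.1 hb).1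
    by_contra hc
    exact this.2 (mem_filter.2 ⟨this.1, not_le.1 hc⟩)
  · have := mem_sdiff.1 hb
    by_contra hc
    exact this.2 (mem_filter.2 ⟨(mem_sdiff.1 this.1).1, not_le.1 hc⟩)
  · have h3 := le_card_sdiff S₁ B₀
    have h4 := le_card_sdiff S₂ (B₀ \ S₁)
    omega

lemma eventually_mul_le_floor {a b : ℝ} (hab : a < b) :
    ∀ᶠ n : ℕ in Filter.atTop, a * n ≤ ⌊b * n⌋₊ := by
  obtain ⟨N, hN⟩ := exists_nat_gt (1 / (b - a))
  filter_upwards [Filter.eventually_ge_atTop N] with n hn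
  have h1 : (N : ℝ) ≤ n := by exact_mod_cast hn
  rw [div_lt_iff₀ (by linarith)] at hN
  have h2 := Nat.lt_floor_add_one (b * n)
  nlinarith

/-- The number of subsets of size at most `s` of a set with at most `4 * n` elements. -/
lemma card_powerset_filter_le_exp {α : Type*} {C : Finset α} {n s : ℕ} {q η θ : ℝ} (hq0 : 0 < q)
    (hq1 : q ≤ 1) (hqθ : 8 * q ≤ θ) (hη : 2 * (η * -Real.log q) ≤ θ) (hC : #C ≤ 4 * n)
    (hs : s ≤ η * n) : (#{S ∈ C.powerset | #S ≤ s} : ℝ) ≤ Real.exp (θ * n) := by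
  have h1 := card_powerset_filter_le C s hq0 hq1
  have h2 : (1 + q) ^ #C ≤ Real.exp (θ / 2 * n) := by
    calc (1 + q) ^ #C ≤ Real.exp q ^ #C := by
          gcongr
          linarith [Real.add_one_le_exp q]
      _ = Real.exp (#C * q) := (Real.exp_nat_mul _ _).symm
      _ ≤ _ := by
          have : (#C : ℝ) ≤ 4 * n := by exact_mod_cast hC
          rw [Real.exp_le_exp]
          nlinarith
  have h3 : Real.exp (-(θ / 2 * n)) ≤ q ^ s := by
    have hlog := Real.log_nonpos hq0.le hq1
    rw [← Real.exp_log hq0, ← Real.exp_nat_mul, Real.exp_le_exp]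
    have : (n : ℝ) * (2 * (η * -Real.log q)) ≤ n * θ := by gcongr
    nlinarith
  have h4 := (mul_le_mul_of_nonneg_left h3 (Nat.cast_nonneg _)).trans (h1.trans h2)
  rw [Real.exp_neg, ← div_eq_mul_inv, div_le_iff₀ (Real.exp_pos _), ← Real.exp_add] at h4
  refine h4.trans_eq ?_
  ring_nf

/-- Rainbow sum-free colourings are captured, up to a subexponential factor, by a container
spanning few rainbow sums. -/
lemma eventually_exists_container {γ δ : ℝ} (hγ : 0 < γ) (hδ : 0 < δ) :
    ∀ᶠ n : ℕ in Filter.atTop, ∀ A ⊆ Icc 1 n, ∃ C : Finset (ℕ × Fin 4),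
      (#(hyperedges RainbowSum C) : ℝ) ≤ γ * n ^ 2 ∧
      (numRSF 4 A : ℝ) ≤ Real.exp (δ * n) * (∏ x ∈ A, #(palette C x) : ℕ) := by
  obtain ⟨k, hk⟩ := exists_nat_gt (4096 / γ)
  rw [div_lt_iff₀ hγ] at hk
  have hk0 : (0 : ℝ) < k := by
    by_contra! h
    nlinarith
  set θ : ℝ := δ / (2 * k) with hθ
  have hθ0 : 0 < θ := by positivity
  set q : ℝ := min 1 (θ / 8) with hq
  have hq0 : 0 < q := by positivity
  have hq1 : q ≤ 1 := min_le_left _ _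
  have hqθ : q ≤ θ / 8 := min_le_right _ _
  have hlog := Real.log_nonpos hq0.le hq1
  set η : ℝ := min (γ / 128) (θ / (2 * (1 - Real.log q))) with hη
  have hη0 : 0 < η := lt_min (by positivity) (div_pos hθ0 (by linarith))
  have hη1 : η ≤ γ / 128 := min_le_left _ _
  have hη2 : η * (2 * (1 - Real.log q)) ≤ θ :=
    (le_div_iff₀ (by linarith)).1 (min_le_right _ _)
  set η' : ℝ := η * γ / 1024 with hη'
  have hη'0 : 0 < η' := by positivity
  have hηη' : 0 < η' * η := by positivity
  filter_upwards [eventually_mul_le_floor (half_lt_self hη0),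
    eventually_mul_le_floor (half_lt_self hη'0),
    eventually_mul_le_floor (show γ / 16 < γ / 8 by linarith), Filter.eventually_gt_atTop 0,
    Filter.eventually_ge_atTop ⌈16 / (η' * η)⌉₊] with n hs ht hg hn hn' A hA
  have hnR : (0 : ℝ) < n := by exact_mod_cast hn
  have hn'' : 16 ≤ n * (η' * η) := by
    rw [← div_le_iff₀ hηη']
    exact (Nat.le_ceil _).trans (by exact_mod_cast hn')
  have hs' : (⌊η * n⌋₊ : ℝ) ≤ η * n := Nat.floor_le (by positivity)
  have ht' : (⌊η' * n⌋₊ : ℝ) ≤ η' * n := Nat.floor_le (by positivity)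
  have hg' : (⌊γ / 8 * n⌋₊ : ℝ) ≤ γ / 8 * n := Nat.floor_le (by positivity)
  set s := ⌊η * n⌋₊
  set t := ⌊η' * n⌋₊
  set g := ⌊γ / 8 * n⌋₊
  clear_value s t g
  have hs0 : (0 : ℝ) < s := lt_of_lt_of_le (by positivity) hs
  have ht0 : (0 : ℝ) < t := lt_of_lt_of_le (by positivity) ht
  have hsg : (8 : ℝ) * s ≤ g := by nlinarith
  have htg : (8 : ℝ) * t * (4 * n) ≤ s * g := by
    calc (8 : ℝ) * t * (4 * n) ≤ 8 * (η' * n) * (4 * n) := by gcongr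
      _ = (η / 2 * n) * (γ / 16 * n) := by rw [hη']; ring
      _ ≤ s * g := by gcongr
  have hts : (4 : ℝ) * n ≤ t * s := by
    calc (4 : ℝ) * n ≤ (η' / 2 * n) * (η / 2 * n) := by nlinarith
      _ ≤ t * s := by gcongr
  have hkg : (64 : ℝ) * (4 * n) ≤ k * g := by
    calc (64 : ℝ) * (4 * n) ≤ k * (γ / 16 * n) := by nlinarith
      _ ≤ k * g := by gcongr
  obtain ⟨C, hC, hcount⟩ := numRSF_le_of_container (k := k) hA hn (by exact_mod_cast hs0)
    (by exact_mod_cast ht0) (by exact_mod_cast hsg) (by exact_mod_cast htg)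
    (by exact_mod_cast hts) (by exact_mod_cast hkg)
  refine ⟨C, ?_, ?_⟩
  · have h1 : (#(hyperedges RainbowSum C) : ℝ) ≤ 2 * g * (4 * n) := by exact_mod_cast hC.le
    nlinarith
  · have hM : #(A ×ˢ (univ : Finset (Fin 4))) ≤ 4 * n := by
      have := card_le_card hA
      simp only [Nat.card_Icc] at this
      rw [card_product, card_univ, Fintype.card_fin]
      omega
    have h1 := card_powerset_filter_le_exp (θ := θ) hq0 hq1 (by linarith) (by nlinarith) hM hs'
    generalize #{S ∈ (A ×ˢ (univ : Finset (Fin 4))).powerset | #S ≤ s} = K at hcount h1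
    generalize ∏ x ∈ A, #(palette C x) = N at hcount ⊢
    calc (numRSF 4 A : ℝ) ≤ ((K : ℝ) ^ 2) ^ k * N := by exact_mod_cast hcount
      _ ≤ (Real.exp (θ * n) ^ 2) ^ k * N := by gcongr
      _ = Real.exp (δ * n) * N := by
          rw [← pow_mul, ← Real.exp_nat_mul]
          congr 2
          rw [hθ]
          push_cast
          field_simp

theorem stmt_5 (ε : ℝ) (hε : 0 < ε) :
    ∃ δ : ℝ, 0 < δ ∧ ∃ n₀ : ℕ, ∀ n : ℕ, n₀ ≤ n → ∀ A ⊆ Finset.Icc 1 n,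
      (4 : ℝ) ^ ((n : ℝ) / 2 - δ * n) ≤ (numRSF 4 A : ℝ) →
      ((symmDiff A (Finset.Icc 1 n)).card : ℝ) ≤ ε * n ∨
      ((symmDiff A ((Finset.Icc 1 n).filter (fun x => Odd x))).card : ℝ) ≤ ε * n ∨
      ((symmDiff A (Finset.Icc (n / 2 + 1) n)).card : ℝ) ≤ ε * n := by
  set c : ℝ := min ε (1 / 25) with hc
  have hc0 : 0 < c := by positivity
  have hcε : c ≤ ε := min_le_left _ _
  have hc1 : c ≤ 1 / 25 := min_le_right _ _
  set κ : ℝ := c / 500 with hκ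
  have hκ0 : 0 < κ := by positivity
  refine ⟨κ / 8, by positivity, ?_⟩
  rw [← Filter.eventually_atTop]
  filter_upwards [eventually_exists_container (show 0 < κ ^ 2 / 4 by positivity)
    (show 0 < κ / 8 by positivity), eventually_mul_le_floor (show κ < c / 400 by linarith),
    Filter.eventually_gt_atTop 0] with n hcont hE hn A hA hcount
  have hnR : (0 : ℝ) < n := by exact_mod_cast hn
  obtain ⟨C, hC, hnum⟩ := hcont A hA
  have hE' : (⌊c / 400 * n⌋₊ : ℝ) ≤ c / 400 * n := Nat.floor_le (by positivity)
  set E := ⌊c / 400 * n⌋₊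
  have hE0 : (0 : ℝ) < E := lt_of_lt_of_le (by positivity) hE
  have hpow : (4 : ℝ) ^ ((n : ℝ) / 2 - κ / 8 * n) = 2 ^ (n - κ / 4 * n) := by
    rw [show (4 : ℝ) = 2 ^ (2 : ℝ) by norm_num, ← Real.rpow_mul (by norm_num)]
    ring_nf
  have hexp : Real.exp (κ / 8 * n) ≤ 2 ^ (κ / 4 * n) := by
    rw [Real.rpow_def_of_pos (by norm_num), Real.exp_le_exp]
    have := Real.log_two_gt_d9
    nlinarith [mul_pos hκ0 hnR]
  have hlow : (2 : ℝ) ^ (n - κ / 2 * n) ≤ (∏ x ∈ A, #(palette C x) : ℕ) := by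
    have h1 := hcount.trans hnum
    rw [hpow] at h1
    have h2 := h1.trans (mul_le_mul_of_nonneg_right hexp (Nat.cast_nonneg _))
    rw [show (n : ℝ) - κ / 4 * n = κ / 4 * n + (n - κ / 2 * n) by ring,
      Real.rpow_add (by norm_num)] at h2
    exact le_of_mul_le_mul_left h2 (by positivity)
  have hpos : ∀ x ∈ A, 1 ≤ #(palette C x) := by
    have : ∏ x ∈ A, #(palette C x) ≠ 0 := by
      intro h
      rw [h, Nat.cast_zero] at hlow
      exact absurd hlow (not_le.2 (by positivity))
    exact fun x hx => Nat.one_le_iff_ne_zero.2 (prod_ne_zero_iff.1 this x hx)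
  have hsum : n - κ / 2 * n ≤
      ((#{x ∈ A | 3 ≤ #(palette C x)} + #{x ∈ A | 2 ≤ #(palette C x)} : ℕ) : ℝ) := by
    have h1 : ((∏ x ∈ A, #(palette C x) : ℕ) : ℝ) ≤ 2 ^ (((#{x ∈ A | 3 ≤ #(palette C x)} +
        #{x ∈ A | 2 ≤ #(palette C x)} : ℕ) : ℝ)) := by
      rw [Real.rpow_natCast]
      exact_mod_cast prod_card_palette_le A C
    exact (Real.rpow_le_rpow_left_iff (by norm_num)).1 (hlow.trans h1)
  obtain ⟨B, D, hBD⟩ := exists_nearSumFree (by exact_mod_cast hE0) hA le_rfl hpos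
    (E := E) fun m hm => by
      have hm' : (m : ℝ) * E ≤ 2 * #(hyperedges RainbowSum C) := by exact_mod_cast hm
      have h1 : m * (κ * n) ≤ κ / 2 * n * (κ * n) :=
        calc m * (κ * n) ≤ m * E := by gcongr
          _ ≤ κ / 2 * n * (κ * n) := by nlinarith
      have h2 := le_of_mul_le_mul_right h1 (by positivity)
      have h3 : (n : ℝ) + m ≤ ((#{x ∈ A | 3 ≤ #(palette C x)} +
        #{x ∈ A | 2 ≤ #(palette C x)} : ℕ) : ℝ) + E := by linarith
      exact_mod_cast h3
  rcases B.eq_empty_or_nonempty with rfl | hB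
  · left
    have h1 := hBD.card_ge
    have h2 := card_le_card hBD.subset_A
    have h3 : symmDiff A (Icc 1 n) = Icc 1 n \ A := by
      rw [symmDiff_def, sdiff_eq_empty_iff_subset.2 hA, sup_eq_union, empty_union]
    rw [h3, card_sdiff_of_subset hA, Nat.card_Icc]
    have h4 : n + 1 - 1 - #A ≤ E := by
      rw [card_empty] at h1
      omega
    have h5 : ((n + 1 - 1 - #A : ℕ) : ℝ) ≤ E := by exact_mod_cast h4
    nlinarith
  · right
    have h4 : (100 : ℝ) * (100 * E : ℕ) ≤ n := by
      push_cast
      nlinarith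
    have h5 : ((4 * (100 * E) : ℕ) : ℝ) ≤ ε * n := by
      push_cast
      nlinarith
    exact (hBD.stability hB le_rfl (by exact_mod_cast h4)).imp
      (fun h => le_trans (by exact_mod_cast h) h5) fun h => le_trans (by exact_mod_cast h) h5
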